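/- Let X be a projective variety over a field k with homogeneous coordinate ring A, and let R be the localization of A at the irrelevant maximal ideal. Then there is an exact sequence 0 → Z → Cl(X) → Cl(R) → 0's left portion: the sequence Z → Cl(X) → Cl(R) is exact with the first map sending 1 to the class of a hyperplane section, and the second map surjective, and the first map injective. -/

import Mathlib

section DivisorClassGroup

/-- The height one primes of `R`. -/
def HeightOnePrime (R : Type) [CommRing R] : Type :=
  {p : PrimeSpectrum R // (Set.Iio p).chainHeight = 1}

/-- The order of vanishing of `f` at the prime `p`: the largest `n` such that `f` lies
in the `n`-th power of the maximal ideal of `R_p` (a junk value for `f = 0`).  For a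
noetherian normal domain and `p` of height one, `R_p` is a discrete valuation ring and
this is the usual valuation. -/
noncomputable def ordAt {R : Type} [CommRing R] (p : PrimeSpectrum R) (f : R) : ℕ :=
  sSup {n : ℕ | algebraMap R (Localization.AtPrime p.asIdeal) f ∈
    (Ideal.map (algebraMap R (Localization.AtPrime p.asIdeal)) p.asIdeal) ^ n}

/-- The subgroup of principal divisors: divisors of nonzero fractions `f/g`. -/
noncomputable def principalDivisors (R : Type) [CommRing R] :
    AddSubgroup (HeightOnePrime R →₀ ℤ) :=
  AddSubgroup.closure {D | ∃ f g : R, f ≠ 0 ∧ g ≠ 0 ∧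
    ∀ p : HeightOnePrime R, D p = (ordAt p.1 f : ℤ) - (ordAt p.1 g : ℤ)}

/-- The divisor class group `Cl(R)` of a (normal noetherian) domain: divisors (formal
`ℤ`-linear combinations of height one primes) modulo principal divisors. -/
abbrev DivClassGroup (R : Type) [CommRing R] : Type :=
  (HeightOnePrime R →₀ ℤ) ⧸ principalDivisors R

end DivisorClassGroup

section ProjClassGroup

variable {k A : Type} [CommRing k] [CommRing A] [Algebra k A]
variable (𝒜 : ℕ → Submodule k A) [GradedAlgebra 𝒜]

/-- The homogeneous, relevant, height one primes of the graded ring `A`; these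
correspond to the prime (Weil) divisors on `X = Proj A`. -/
def RelevantHeightOnePrime : Type :=
  {p : PrimeSpectrum A // p.asIdeal.IsHomogeneous 𝒜 ∧ (Set.Iio p).chainHeight = 1 ∧
    ¬ (HomogeneousIdeal.irrelevant 𝒜).toIdeal ≤ p.asIdeal}

/-- Principal divisors on `X = Proj A`: divisors of ratios `f/g` of nonzero
homogeneous elements of the same degree. -/
noncomputable def projPrincipalDivisors : AddSubgroup (RelevantHeightOnePrime 𝒜 →₀ ℤ) :=
  AddSubgroup.closure {D | ∃ (d : ℕ) (f g : A), f ∈ 𝒜 d ∧ g ∈ 𝒜 d ∧ f ≠ 0 ∧ g ≠ 0 ∧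
    ∀ p : RelevantHeightOnePrime 𝒜, D p = (ordAt p.1 f : ℤ) - (ordAt p.1 g : ℤ)}

/-- The divisor class group `Cl(X)` of `X = Proj A`. -/
abbrev ClProj : Type := (RelevantHeightOnePrime 𝒜 →₀ ℤ) ⧸ projPrincipalDivisors 𝒜

end ProjClassGroup

open IsLocalRing in
/-- In a noetherian integrally closed local domain, if the class of `b` modulo `a` is nonzero and
killed by the maximal ideal, then the maximal ideal is generated by `a / b`. -/
theorem IsLocalRing.exists_mul_eq_of_isIntegrallyClosed {S : Type*} [CommRing S] [IsDomain S]
    [IsLocalRing S] [IsNoetherianRing S] [IsIntegrallyClosed S] {a b : S} (ha₂ : a ≠ 0)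
    (ha₁ : a ∈ maximalIdeal S) (hb₂ : b ∉ Ideal.span {a})
    (hb₃ : ∀ m ∈ maximalIdeal S, ∃ c : S, c * a = b * m) :
    ∃ y, b * y = a ∧ maximalIdeal S = Ideal.span {y} := by
  have hb₄ : b ≠ 0 := by rintro rfl; apply hb₂; exact zero_mem _
  let K := FractionRing S
  let x : K := algebraMap S K b / algebraMap S K a
  let M := Submodule.map (Algebra.linearMap S K) (maximalIdeal S)
  have ha₃ : algebraMap S K a ≠ 0 := IsFractionRing.to_map_eq_zero_iff.not.mpr ha₂
  by_cases hx : ∀ y ∈ M, x * y ∈ M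
  · have := isIntegral_of_smul_mem_submodule M ?_ ?_ x hx
    · obtain ⟨y, e⟩ := IsIntegrallyClosed.algebraMap_eq_of_integral this
      refine (hb₂ (Ideal.mem_span_singleton'.mpr ⟨y, ?_⟩)).elim
      apply IsFractionRing.injective S K
      rw [map_mul, e, div_mul_cancel₀ _ ha₃]
    · rw [Submodule.ne_bot_iff]; refine ⟨_, ⟨a, ha₁, rfl⟩, ?_⟩
      exact (IsFractionRing.to_map_eq_zero_iff (K := K)).not.mpr ha₂
    · apply Submodule.FG.map; exact IsNoetherian.noetherian _
  · push Not at hx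
    obtain ⟨_, ⟨m, hm, rfl⟩, hxm⟩ := hx
    obtain ⟨c, hc⟩ := hb₃ m hm
    have hcu : IsUnit c := by
      by_contra hcu
      refine hxm ⟨c, hcu, ?_⟩
      rw [Algebra.linearMap_apply, Algebra.linearMap_apply, ← mul_div_right_comm, ← map_mul, ← hc,
        map_mul, mul_div_cancel_right₀ _ ha₃]
    obtain ⟨u, rfl⟩ := hcu
    have hy : b * (↑u⁻¹ * m) = a := by
      rw [mul_left_comm, ← hc, Units.inv_mul_cancel_left]
    refine ⟨↑u⁻¹ * m, hy, le_antisymm (fun n hn ↦ ?_) ?_⟩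
    · obtain ⟨d, hd⟩ := hb₃ n hn
      rw [← hy, mul_left_comm] at hd
      exact Ideal.mem_span_singleton'.mpr ⟨d, mul_left_cancel₀ hb₄ hd⟩
    · rw [Ideal.span_singleton_le_iff_mem]
      exact Ideal.mul_mem_left _ _ hm

section HeightOne

variable {R : Type} [CommRing R] [IsDomain R]

theorem chainHeight_Iio_eq_one_iff (p : PrimeSpectrum R) :
    (Set.Iio p).chainHeight = 1 ↔
      p.asIdeal ≠ ⊥ ∧ ∀ q : PrimeSpectrum R, q.asIdeal ≠ ⊥ → q ≤ p → q = p := by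
  have hbot : ∀ q : PrimeSpectrum R, q.asIdeal ≠ ⊥ ↔ q ≠ ⊥ := fun q ↦ by
    rw [Ne, Ne, PrimeSpectrum.ext_iff]; rfl
  simp only [hbot]
  constructor
  · intro h
    have h' := congrFun h (fun _ _ ↦ True)
    have hsub : (Set.Iio p).Subsingleton := by
      rw [← Set.encard_le_one_iff_subsingleton, ← Pi.one_apply (M := fun _ ↦ ℕ∞), ← h']
      exact Set.encard_le_chainHeight_of_isChain _ _ subset_rfl fun _ _ _ _ _ ↦ Or.inl trivial
    have hne : (Set.Iio p).Nonempty := (Set.one_le_chainHeight_iff _ _).mp h'.ge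
    obtain ⟨q, hq⟩ := hne
    have hp : (⊥ : PrimeSpectrum R) < p := bot_le.trans_lt hq
    refine ⟨hp.ne', fun q hq hqp ↦ ?_⟩
    by_contra hne
    exact hq (hsub (lt_of_le_of_ne hqp hne) hp)
  · rintro ⟨hp, h⟩
    funext r
    refine le_antisymm ((Set.chainHeight_le_encard _ _).trans ?_) ?_
    · refine Set.encard_le_one_iff_subsingleton.mpr ?_
      have : ∀ q ∈ Set.Iio p, q = ⊥ := fun q hq ↦ by
        by_contra hq'
        exact hq.ne (h q hq' hq.le)
      intro a ha b hb
      rw [this a ha, this b hb]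
    · exact (Set.one_le_chainHeight_iff _ _).mpr ⟨⊥, bot_lt_iff_ne_bot.mpr hp⟩

theorem not_isField_localization_atPrime {p : PrimeSpectrum R} (hp : p.asIdeal ≠ ⊥) :
    ¬ IsField (Localization.AtPrime p.asIdeal) := by
  intro h
  obtain ⟨x, hx, hx0⟩ := Submodule.exists_mem_ne_zero_of_ne_bot hp
  have hmem := (IsLocalization.AtPrime.to_map_mem_maximal_iff
    (Localization.AtPrime p.asIdeal) p.asIdeal x).mpr hx
  rw [IsLocalRing.isField_iff_maximalIdeal_eq.mp h, Ideal.mem_bot] at hmem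
  exact hx0 (IsLocalization.injective (Localization.AtPrime p.asIdeal)
    p.asIdeal.primeCompl_le_nonZeroDivisors (hmem.trans (map_zero _).symm))

variable [IsNoetherianRing R]

theorem isDiscreteValuationRing_of_chainHeight [IsIntegrallyClosed R] {p : PrimeSpectrum R}
    (hp : (Set.Iio p).chainHeight = 1) :
    IsDiscreteValuationRing (Localization.AtPrime p.asIdeal) := by
  rw [chainHeight_Iio_eq_one_iff] at hp
  have hf := not_isField_localization_atPrime hp.1
  have hic : IsIntegrallyClosed (Localization.AtPrime p.asIdeal) :=
    isIntegrallyClosed_of_isLocalization _ p.asIdeal.primeCompl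
      p.asIdeal.primeCompl_le_nonZeroDivisors
  have hiff := (IsDiscreteValuationRing.TFAE (Localization.AtPrime p.asIdeal) hf).out 0 3
  refine hiff.mpr ⟨hic, IsLocalRing.maximalIdeal _, ⟨fun h ↦ hf (IsLocalRing.isField_iff_maximalIdeal_eq.mpr h),
      inferInstance⟩, fun P ⟨hP, hPp⟩ ↦ ?_⟩
  have key := hp.2 ⟨P.under R, inferInstance⟩ (fun h ↦ hP ?_) ?_
  · rw [← IsLocalization.map_under p.asIdeal.primeCompl _ P,
      ← Localization.AtPrime.map_eq_maximalIdeal]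
    exact congrArg (Ideal.map _) (congrArg PrimeSpectrum.asIdeal key)
  · rw [← IsLocalization.map_under p.asIdeal.primeCompl (Localization.AtPrime p.asIdeal) P]
    exact (congrArg (Ideal.map _) h).trans Ideal.map_bot
  · exact (Ideal.comap_mono (IsLocalRing.le_maximalIdeal hPp.ne_top)).trans_eq
      Localization.AtPrime.under_maximalIdeal

variable [IsIntegrallyClosed R]

section

variable {p : PrimeSpectrum R} (hp : (Set.Iio p).chainHeight = 1)
include hp

theorem exists_irreducible_forall_associated_ordAt :
    ∃ ϖ : Localization.AtPrime p.asIdeal, Irreducible ϖ ∧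
      ∀ f : R, f ≠ 0 → Associated (algebraMap R _ f) (ϖ ^ ordAt p f) := by
  have := isDiscreteValuationRing_of_chainHeight hp
  obtain ⟨ϖ, hϖ⟩ := IsDiscreteValuationRing.exists_irreducible (Localization.AtPrime p.asIdeal)
  refine ⟨ϖ, hϖ, fun f hf ↦ ?_⟩
  obtain ⟨n, hn⟩ := IsDiscreteValuationRing.associated_pow_irreducible
    (x := algebraMap R (Localization.AtPrime p.asIdeal) f) (fun h ↦ hf
    (IsLocalization.injective (Localization.AtPrime p.asIdeal)
      p.asIdeal.primeCompl_le_nonZeroDivisors (h.trans (map_zero _).symm))) hϖ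
  suffices ordAt p f = n by rwa [this]
  have : {n : ℕ | algebraMap R (Localization.AtPrime p.asIdeal) f ∈
    (Ideal.map (algebraMap R (Localization.AtPrime p.asIdeal)) p.asIdeal) ^ n} = Set.Iic n := by
    ext m
    rw [Set.mem_ofPred_eq, Localization.AtPrime.map_eq_maximalIdeal, hϖ.maximalIdeal_eq,
      Ideal.span_singleton_pow, Ideal.mem_span_singleton, hn.dvd_iff_dvd_right,
      pow_dvd_pow_iff hϖ.ne_zero hϖ.not_isUnit, Set.mem_Iic]
  rw [ordAt, this, csSup_Iic]

theorem mem_pow_iff_le_ordAt {f : R} (hf : f ≠ 0) (n : ℕ) :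
    algebraMap R (Localization.AtPrime p.asIdeal) f ∈
      IsLocalRing.maximalIdeal (Localization.AtPrime p.asIdeal) ^ n ↔ n ≤ ordAt p f := by
  have := isDiscreteValuationRing_of_chainHeight hp
  obtain ⟨ϖ, hϖ, h⟩ := exists_irreducible_forall_associated_ordAt hp
  rw [hϖ.maximalIdeal_eq, Ideal.span_singleton_pow, Ideal.mem_span_singleton,
    (h f hf).dvd_iff_dvd_right, pow_dvd_pow_iff hϖ.ne_zero hϖ.not_isUnit]

theorem ordAt_mul {f g : R} (hf : f ≠ 0) (hg : g ≠ 0) :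
    ordAt p (f * g) = ordAt p f + ordAt p g := by
  have := isDiscreteValuationRing_of_chainHeight hp
  obtain ⟨ϖ, hϖ, h⟩ := exists_irreducible_forall_associated_ordAt hp
  have h1 := (h f hf).mul_mul (h g hg)
  rw [← map_mul, ← pow_add] at h1
  have h2 := (h _ (mul_ne_zero hf hg)).symm.trans h1
  exact le_antisymm ((pow_dvd_pow_iff hϖ.ne_zero hϖ.not_isUnit).mp h2.dvd)
    ((pow_dvd_pow_iff hϖ.ne_zero hϖ.not_isUnit).mp h2.symm.dvd)

theorem ordAt_eq_zero_iff {f : R} (hf : f ≠ 0) : ordAt p f = 0 ↔ f ∉ p.asIdeal := by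
  rw [← IsLocalization.AtPrime.to_map_mem_maximal_iff (Localization.AtPrime p.asIdeal) p.asIdeal f,
    ← pow_one (IsLocalRing.maximalIdeal _), mem_pow_iff_le_ordAt hp hf]
  omega

theorem ordAt_one : ordAt p (1 : R) = 0 :=
  (ordAt_eq_zero_iff hp one_ne_zero).mpr fun h ↦ p.2.ne_top ((Ideal.eq_top_iff_one _).mpr h)

theorem ordAt_pow {f : R} (hf : f ≠ 0) (n : ℕ) : ordAt p (f ^ n) = n * ordAt p f := by
  induction n with
  | zero => simp [ordAt_one hp]
  | succ n ih => rw [pow_succ, ordAt_mul hp (pow_ne_zero _ hf) hf, ih]; ring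

/-- A set generating the prime `p` contains a uniformizer at `p`. -/
theorem exists_mem_ordAt_eq_one_of_span {s : Set R} (hs : Ideal.span s = p.asIdeal) :
    ∃ f ∈ s, f ≠ 0 ∧ ordAt p f = 1 := by
  have := isDiscreteValuationRing_of_chainHeight hp
  by_contra! h
  have hle : IsLocalRing.maximalIdeal (Localization.AtPrime p.asIdeal) ≤
      IsLocalRing.maximalIdeal (Localization.AtPrime p.asIdeal) ^ 2 := by
    have hmap := Ideal.map_span (algebraMap R (Localization.AtPrime p.asIdeal)) s
    simp only [hs, Localization.AtPrime.map_eq_maximalIdeal] at hmap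
    refine hmap.trans_le (Ideal.span_le.mpr ?_)
    rintro _ ⟨f, hf, rfl⟩
    rcases eq_or_ne f 0 with rfl | hf0
    · simp
    · refine (mem_pow_iff_le_ordAt hp hf0 2).mpr ?_
      have h1 := h f hf hf0
      have h2 := (ordAt_eq_zero_iff hp hf0).not_left.mpr (hs ▸ Ideal.subset_span hf)
      omega
  obtain ⟨ϖ, hϖ⟩ := IsDiscreteValuationRing.exists_irreducible (Localization.AtPrime p.asIdeal)
  rw [hϖ.maximalIdeal_eq, Ideal.span_singleton_pow, Ideal.span_singleton_le_span_singleton] at hle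
  have := (pow_dvd_pow_iff (n := 2) (m := 1) hϖ.ne_zero hϖ.not_isUnit).mp (by rwa [pow_one])
  omega

end

theorem exists_ordAt_lt_of_not_dvd {f g : R} (hg : g ≠ 0) (hfg : ¬ g ∣ f) :
    ∃ p : HeightOnePrime R, ordAt p.1 f < ordAt p.1 g := by
  have hf : f ≠ 0 := by rintro rfl; exact hfg (dvd_zero g)
  let x : R ⧸ Ideal.span {g} := Ideal.Quotient.mk _ f
  let y : Submodule.span R {x} := ⟨x, Submodule.mem_span_singleton_self x⟩
  have hx : y ≠ 0 := by
    intro h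
    exact hfg (Ideal.mem_span_singleton.mp (Ideal.Quotient.eq_zero_iff_mem.mp
      (congrArg Subtype.val h)))
  obtain ⟨P, hPass, -⟩ := exists_le_isAssociatedPrime_of_isNoetherianRing R y hx
  obtain ⟨hP, ⟨z, hz⟩, hPz⟩ := isAssociatedPrime_iff.mp hPass
  obtain ⟨c, rfl⟩ := Submodule.mem_span_singleton.mp hz
  have hmem : ∀ a, a ∈ P ↔ g ∣ c * f * a := fun a ↦ by
    rw [hPz, Submodule.mem_colon_singleton, Submodule.mem_bot, ← Subtype.val_inj,
      ← Ideal.mem_span_singleton, ← Ideal.Quotient.eq_zero_iff_mem, mul_comm, map_mul, map_mul]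
    rfl
  have hgP : g ∈ P := (hmem g).mpr (dvd_mul_left _ _)
  have hPbot : P ≠ ⊥ := by
    rintro rfl
    exact hg hgP
  let S := Localization.AtPrime P
  have hinj := IsLocalization.injective S P.primeCompl_le_nonZeroDivisors
  have hic : IsIntegrallyClosed S :=
    isIntegrallyClosed_of_isLocalization _ P.primeCompl P.primeCompl_le_nonZeroDivisors
  have hmax : ∀ a, algebraMap R S a ∈ IsLocalRing.maximalIdeal S ↔ a ∈ P :=
    IsLocalization.AtPrime.to_map_mem_maximal_iff S P
  have hcf : algebraMap R S (c * f) ∉ Ideal.span {algebraMap R S g} := by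
    intro h
    rw [← Set.image_singleton, ← Ideal.map_span,
      IsLocalization.algebraMap_mem_map_algebraMap_iff P.primeCompl] at h
    obtain ⟨s, hs, h⟩ := h
    rw [Ideal.mem_span_singleton, mul_comm] at h
    exact hs ((hmem s).mpr h)
  have hcm : ∀ m ∈ IsLocalRing.maximalIdeal S,
      ∃ d, d * algebraMap R S g = algebraMap R S (c * f) * m := by
    intro m hm
    obtain ⟨r, s, rfl⟩ := IsLocalization.exists_mk'_eq P.primeCompl m
    rw [IsLocalization.mk'_mem_iff, hmax, hmem] at hm
    obtain ⟨d, hd⟩ := hm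
    refine ⟨IsLocalization.mk' S d s, ?_⟩
    rw [mul_comm, IsLocalization.mul_mk'_eq_mk'_of_mul, ← hd, IsLocalization.mul_mk'_eq_mk'_of_mul]
  obtain ⟨y, hy, hspan⟩ := IsLocalRing.exists_mul_eq_of_isIntegrallyClosed
    (fun h ↦ hg (hinj (h.trans (map_zero _).symm))) ((hmax g).mpr hgP) hcf hcm
  have hiff := (IsDiscreteValuationRing.TFAE S (not_isField_localization_atPrime
    (p := ⟨P, hP⟩) hPbot)).out 0 4
  have hdvr : IsDiscreteValuationRing S := hiff.mpr ⟨y, hspan⟩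
  have hht : (Set.Iio (⟨P, hP⟩ : PrimeSpectrum R)).chainHeight = 1 := by
    rw [chainHeight_Iio_eq_one_iff]
    refine ⟨hPbot, fun q hq hqP ↦ PrimeSpectrum.ext ?_⟩
    have hdisj : Disjoint (P.primeCompl : Set R) q.asIdeal :=
      Set.disjoint_left.mpr fun a ha haq ↦ ha (hqP haq)
    have hqp := IsLocalization.isPrime_of_isPrime_disjoint P.primeCompl S q.asIdeal q.2 hdisj
    have hqmax := hqp.isMaximal fun h ↦ hq (Ideal.map_eq_bot_iff_of_injective hinj |>.mp h)
    rw [← IsLocalization.under_map_of_isPrime_disjoint P.primeCompl S q.2 hdisj,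
      IsLocalRing.eq_maximalIdeal hqmax]
    exact Localization.AtPrime.under_maximalIdeal
  refine ⟨⟨⟨P, hP⟩, hht⟩, ?_⟩
  rw [← Nat.add_one_le_iff, ← mem_pow_iff_le_ordAt hht hg, ← hy, pow_succ]
  refine Ideal.mul_mem_mul ?_ (hspan ▸ Ideal.mem_span_singleton_self y)
  rw [map_mul]
  exact Ideal.mul_mem_left _ _ ((mem_pow_iff_le_ordAt hht hf _).mpr le_rfl)

theorem dvd_of_ordAt_le {f g : R} (hg : g ≠ 0)
    (h : ∀ p : HeightOnePrime R, ordAt p.1 g ≤ ordAt p.1 f) : g ∣ f := by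
  by_contra hfg
  obtain ⟨p, hp⟩ := exists_ordAt_lt_of_not_dvd hg hfg
  exact hp.not_ge (h p)

theorem finite_setOf_ordAt_ne_zero {f : R} (hf : f ≠ 0) :
    {p : HeightOnePrime R | ordAt p.1 f ≠ 0}.Finite := by
  refine Set.Finite.of_finite_image (f := fun p ↦ p.1.asIdeal)
    ((Ideal.span {f}).finite_minimalPrimes_of_isNoetherianRing.subset ?_) ?_
  · rintro _ ⟨p, hp, rfl⟩
    have hfp := (ordAt_eq_zero_iff p.2 hf).not_left.mp hp
    refine ⟨⟨p.1.2, (Ideal.span_singleton_le_iff_mem _).mpr hfp⟩, fun q ⟨hq, hfq⟩ hqp ↦ ?_⟩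
    refine (congrArg PrimeSpectrum.asIdeal (((chainHeight_Iio_eq_one_iff _).mp p.2).2 ⟨q, hq⟩ ?_ hqp)).ge
    rintro (rfl : q = ⊥)
    exact hf ((Ideal.span_singleton_le_iff_mem _).mp hfq)
  · exact fun p _ q _ h ↦ Subtype.ext (PrimeSpectrum.ext h)

end HeightOne

section PrincipalDivisors

variable {R : Type} [CommRing R] [IsDomain R] [IsNoetherianRing R] [IsIntegrallyClosed R]

theorem mem_principalDivisors_iff {D : HeightOnePrime R →₀ ℤ} :
    D ∈ principalDivisors R ↔ ∃ f g : R, f ≠ 0 ∧ g ≠ 0 ∧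
      ∀ p : HeightOnePrime R, D p = (ordAt p.1 f : ℤ) - (ordAt p.1 g : ℤ) := by
  refine ⟨fun h ↦ ?_, fun h ↦ AddSubgroup.subset_closure h⟩
  induction h using AddSubgroup.closure_induction with
  | mem D h => exact h
  | zero => exact ⟨1, 1, one_ne_zero, one_ne_zero, fun p ↦ by simp⟩
  | add D E _ _ hD hE =>
    obtain ⟨f, g, hf, hg, h⟩ := hD
    obtain ⟨f', g', hf', hg', h'⟩ := hE
    refine ⟨f * f', g * g', mul_ne_zero hf hf', mul_ne_zero hg hg', fun p ↦ ?_⟩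
    rw [Finsupp.add_apply, h, h', ordAt_mul p.2 hf hf', ordAt_mul p.2 hg hg']
    push_cast
    ring
  | neg D _ hD =>
    obtain ⟨f, g, hf, hg, h⟩ := hD
    exact ⟨g, f, hg, hf, fun p ↦ by rw [Finsupp.neg_apply, h]; ring⟩

/-- The divisor of an element of a noetherian normal domain (`0` for the element `0`). -/
noncomputable def divisorOf (f : R) : HeightOnePrime R →₀ ℤ :=
  open Classical in
  if hf : f = 0 then 0 else
    Finsupp.ofSupportFinite (fun p ↦ (ordAt p.1 f : ℤ)) (by
      refine (finite_setOf_ordAt_ne_zero hf).subset fun p hp ↦ ?_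
      exact fun h ↦ hp (by simp [h]))

theorem divisorOf_apply {f : R} (hf : f ≠ 0) (p : HeightOnePrime R) :
    divisorOf f p = ordAt p.1 f := by
  rw [divisorOf, dif_neg hf]
  rfl

theorem divisorOf_mem_principalDivisors {f : R} (hf : f ≠ 0) :
    divisorOf f ∈ principalDivisors R :=
  mem_principalDivisors_iff.mpr ⟨f, 1, hf, one_ne_zero, fun p ↦ by
    simp [divisorOf_apply hf, ordAt_one p.2]⟩

end PrincipalDivisors

section Localization

variable {A : Type} [CommRing A]

theorem algebraMap_mem_map_pow_iff (p : PrimeSpectrum A) (f : A) (n : ℕ) :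
    algebraMap A (Localization.AtPrime p.asIdeal) f ∈
      (Ideal.map (algebraMap A (Localization.AtPrime p.asIdeal)) p.asIdeal) ^ n ↔
      ∃ s ∉ p.asIdeal, s * f ∈ p.asIdeal ^ n := by
  rw [← Ideal.map_pow, IsLocalization.algebraMap_mem_map_algebraMap_iff p.asIdeal.primeCompl]
  rfl

variable {P : Ideal A} [P.IsPrime]

theorem ordAt_algebraMap_localization {p : PrimeSpectrum A}
    {q : PrimeSpectrum (Localization.AtPrime P)} (hp : p.asIdeal ≤ P)
    (hq : q.asIdeal = p.asIdeal.map (algebraMap A _)) (f : A) :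
    ordAt q (algebraMap A _ f) = ordAt p f := by
  have hcomap : ∀ a, algebraMap A (Localization.AtPrime P) a ∈ q.asIdeal ↔ a ∈ p.asIdeal := by
    intro a
    rw [hq, IsLocalization.algebraMap_mem_map_algebraMap_iff P.primeCompl]
    exact ⟨fun ⟨m, hm, h⟩ ↦ (p.2.mem_or_mem h).resolve_left fun h' ↦ hm (hp h'),
      fun h ↦ ⟨1, fun h1 ↦ (‹P.IsPrime›.ne_top ((Ideal.eq_top_iff_one _).mpr h1)), by simpa⟩⟩
  unfold ordAt
  congr 1
  ext n
  rw [Set.mem_ofPred_eq, Set.mem_ofPred_eq, algebraMap_mem_map_pow_iff, algebraMap_mem_map_pow_iff]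
  constructor
  · rintro ⟨s, hs, hsf⟩
    obtain ⟨s, t, rfl⟩ := IsLocalization.exists_mk'_eq P.primeCompl s
    rw [IsLocalization.mk'_mem_iff, hcomap] at hs
    rw [mul_comm, IsLocalization.mul_mk'_eq_mk'_of_mul, IsLocalization.mk'_mem_iff, hq,
      ← Ideal.map_pow, IsLocalization.algebraMap_mem_map_algebraMap_iff P.primeCompl] at hsf
    obtain ⟨u, hu, h⟩ := hsf
    exact ⟨u * s, fun h' ↦ (p.2.mem_or_mem h').elim (fun h' ↦ hu (hp h')) hs, by
      rwa [mul_assoc, mul_comm s]⟩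
  · rintro ⟨s, hs, h⟩
    refine ⟨algebraMap A _ s, fun h' ↦ hs ((hcomap s).mp h'), ?_⟩
    rw [← map_mul, hq, ← Ideal.map_pow]
    exact Ideal.mem_map_of_mem _ h

variable [IsDomain A]

theorem chainHeight_Iio_comap_localization {q : PrimeSpectrum (Localization.AtPrime P)}
    (hq : (Set.Iio q).chainHeight = 1) :
    (Set.Iio (PrimeSpectrum.comap (algebraMap A (Localization.AtPrime P)) q)).chainHeight = 1 := by
  rw [chainHeight_Iio_eq_one_iff] at hq ⊢
  have hmap := IsLocalization.map_under P.primeCompl (Localization.AtPrime P) q.asIdeal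
  refine ⟨fun h ↦ hq.1 ?_, fun p hp hpq ↦ ?_⟩
  · rw [← hmap]
    exact (congrArg (Ideal.map _) h).trans Ideal.map_bot
  · have hpP : p.asIdeal ≤ P := (show p.asIdeal ≤ q.asIdeal.under A from hpq).trans
      ((Ideal.comap_mono (IsLocalRing.le_maximalIdeal q.2.ne_top)).trans_eq
        Localization.AtPrime.under_maximalIdeal)
    have hdisj : Disjoint (P.primeCompl : Set A) p.asIdeal :=
      Set.disjoint_left.mpr fun a ha haq ↦ ha (hpP haq)
    have hunder := IsLocalization.under_map_of_isPrime_disjoint P.primeCompl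
      (Localization.AtPrime P) p.2 hdisj
    have := hq.2 ⟨p.asIdeal.map (algebraMap A _),
      IsLocalization.isPrime_of_isPrime_disjoint P.primeCompl _ p.asIdeal p.2 hdisj⟩
      (fun h ↦ hp ?_) ?_
    · ext1
      rw [← this]
      exact hunder.symm
    · rw [← hunder]
      exact (congrArg (Ideal.under A) h).trans (Ideal.comap_bot_of_injective _
        (IsLocalization.injective _ P.primeCompl_le_nonZeroDivisors))
    · exact Ideal.map_le_iff_le_comap.mpr hpq

/-- The extension of a height one prime of `A` contained in `P` to the localization at `P`. -/
def HeightOnePrime.mapAtPrime (p : PrimeSpectrum A) (hp : (Set.Iio p).chainHeight = 1)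
    (hpP : p.asIdeal ≤ P) : HeightOnePrime (Localization.AtPrime P) :=
  ⟨⟨p.asIdeal.map (algebraMap A _), IsLocalization.isPrime_of_isPrime_disjoint P.primeCompl _
    p.asIdeal p.2 (Set.disjoint_left.mpr fun _ ha haq ↦ ha (hpP haq))⟩, by
    have hunder := IsLocalization.under_map_of_isPrime_disjoint P.primeCompl
      (Localization.AtPrime P) p.2 (Set.disjoint_left.mpr fun _ ha haq ↦ ha (hpP haq))
    rw [chainHeight_Iio_eq_one_iff] at hp ⊢
    refine ⟨fun h ↦ hp.1 ?_, fun q hq hqp ↦ ?_⟩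
    · rw [← hunder]
      exact (congrArg (Ideal.under A) h).trans (Ideal.comap_bot_of_injective _
        (IsLocalization.injective _ P.primeCompl_le_nonZeroDivisors))
    · have hmap := IsLocalization.map_under P.primeCompl (Localization.AtPrime P) q.asIdeal
      have := hp.2 (PrimeSpectrum.comap (algebraMap A _) q) (fun h ↦ hq ?_)
        ((Ideal.comap_mono hqp).trans_eq hunder)
      · ext1
        rw [← hmap]
        exact congrArg (Ideal.map _) (congrArg PrimeSpectrum.asIdeal this)
      · rw [← hmap]
        exact (congrArg (Ideal.map _) h).trans Ideal.map_bot⟩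

/-- The contraction of a height one prime of the localization at `P`. -/
def HeightOnePrime.comapAtPrime (q : HeightOnePrime (Localization.AtPrime P)) :
    HeightOnePrime A :=
  ⟨PrimeSpectrum.comap (algebraMap A _) q.1, chainHeight_Iio_comap_localization q.2⟩

theorem HeightOnePrime.comapAtPrime_le (q : HeightOnePrime (Localization.AtPrime P)) :
    q.comapAtPrime.1.asIdeal ≤ P :=
  (Ideal.comap_mono (IsLocalRing.le_maximalIdeal q.1.2.ne_top)).trans_eq
    Localization.AtPrime.under_maximalIdeal

theorem HeightOnePrime.map_comapAtPrime (q : HeightOnePrime (Localization.AtPrime P)) :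
    q.1.asIdeal = q.comapAtPrime.1.asIdeal.map (algebraMap A _) :=
  (IsLocalization.map_under P.primeCompl (Localization.AtPrime P) q.1.asIdeal).symm

theorem HeightOnePrime.ordAt_algebraMap (q : HeightOnePrime (Localization.AtPrime P)) (f : A) :
    ordAt q.1 (algebraMap A _ f) = ordAt q.comapAtPrime.1 f :=
  ordAt_algebraMap_localization q.comapAtPrime_le q.map_comapAtPrime f

theorem HeightOnePrime.comapAtPrime_mapAtPrime {p : PrimeSpectrum A}
    (hp : (Set.Iio p).chainHeight = 1) (hpP : p.asIdeal ≤ P) :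
    (mapAtPrime p hp hpP).comapAtPrime.1 = p :=
  PrimeSpectrum.ext (IsLocalization.under_map_of_isPrime_disjoint P.primeCompl
    (Localization.AtPrime P) p.2 (Set.disjoint_left.mpr fun _ ha haq ↦ ha (hpP haq)))

theorem HeightOnePrime.mapAtPrime_comapAtPrime (q : HeightOnePrime (Localization.AtPrime P)) :
    mapAtPrime q.comapAtPrime.1 q.comapAtPrime.2 q.comapAtPrime_le = q :=
  Subtype.ext (PrimeSpectrum.ext q.map_comapAtPrime.symm)

end Localization

section GradedPolynomial

open DirectSum Polynomial

variable {k A : Type} [CommRing k] [CommRing A] [Algebra k A]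
variable (𝒜 : ℕ → Submodule k A) [GradedAlgebra 𝒜]

/-- The ring homomorphism `∑ fᵢ ↦ ∑ fᵢ Tⁱ` from a graded ring to polynomials over it. -/
noncomputable def gradedToPolynomial : A →+* A[X] :=
  (DirectSum.toSemiring
    (fun i ↦ (monomial i).toAddMonoidHom.comp (𝒜 i).subtype.toAddMonoidHom) rfl
    (fun {i j} a b ↦ (monomial_mul_monomial i j (a : A) (b : A)).symm)).comp
    (decomposeRingEquiv 𝒜).toRingHom

theorem coeff_gradedToPolynomial (f : A) (i : ℕ) :
    (gradedToPolynomial 𝒜 f).coeff i = GradedRing.proj 𝒜 i f := by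
  induction f using Decomposition.inductionOn 𝒜 with
  | zero => simp
  | add f g hf hg => rw [map_add, coeff_add, hf, hg, map_add]
  | @homogeneous j f =>
    have : gradedToPolynomial 𝒜 (f : A) = monomial j (f : A) := by
      simp only [gradedToPolynomial, RingHom.comp_apply]
      change DirectSum.toSemiring _ _ _ (decompose 𝒜 (f : A)) = _
      rw [decompose_coe]
      exact toSemiring_of _ _ _ _ _
    rw [this, coeff_monomial, GradedRing.proj_apply]
    split_ifs with h
    · subst h
      simp
    · rw [decompose_of_mem_ne 𝒜 f.2 h]

theorem proj_mem (i : ℕ) (f : A) : GradedRing.proj 𝒜 i f ∈ 𝒜 i := (decompose 𝒜 f i).2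

theorem sum_proj (f : A) : ∃ s : Finset ℕ, ∑ i ∈ s, GradedRing.proj 𝒜 i f = f := by
  classical
  exact ⟨_, sum_support_decompose 𝒜 f⟩

theorem eq_zero_of_forall_proj {f : A} (h : ∀ i, GradedRing.proj 𝒜 i f = 0) : f = 0 := by
  obtain ⟨s, hs⟩ := sum_proj 𝒜 f
  rw [← hs]
  exact Finset.sum_eq_zero fun i _ ↦ h i

theorem mem_of_forall_proj_mem {I : Ideal A} {f : A} (h : ∀ i, GradedRing.proj 𝒜 i f ∈ I) :
    f ∈ I := by
  obtain ⟨s, hs⟩ := sum_proj 𝒜 f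
  rw [← hs]
  exact Ideal.sum_mem _ fun i _ ↦ h i

end GradedPolynomial

section GradedDomain

open DirectSum Polynomial

variable {k A : Type} [CommRing k] [CommRing A] [IsDomain A] [Algebra k A]
variable {𝒜 : ℕ → Submodule k A} [GradedAlgebra 𝒜]

theorem isHomogeneous_of_mem {q : PrimeSpectrum A} (hq : (Set.Iio q).chainHeight = 1)
    {f : A} {d : ℕ} (hf : f ∈ 𝒜 d) (hf0 : f ≠ 0) (hfq : f ∈ q.asIdeal) :
    q.asIdeal.IsHomogeneous 𝒜 := by
  have hcore : (q.asIdeal.homogeneousCore 𝒜).toIdeal.IsPrime := q.2.homogeneousCore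
  have h := ((chainHeight_Iio_eq_one_iff q).mp hq).2 ⟨_, hcore⟩ (fun h ↦ hf0 ?_)
    (Ideal.toIdeal_homogeneousCore_le 𝒜 _)
  · rw [Ideal.IsHomogeneous.iff_eq]
    exact congrArg PrimeSpectrum.asIdeal h
  · have := Ideal.mem_homogeneousCore_of_homogeneous_of_mem ⟨d, hf⟩ hfq
    exact (Submodule.mem_bot A).mp (h ▸ this)

theorem Ideal.IsHomogeneous.pow {R : Type} [CommRing R] [Algebra k R] {ℬ : ℕ → Submodule k R}
    [GradedAlgebra ℬ] {I : Ideal R} (h : I.IsHomogeneous ℬ) (n : ℕ) :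
    (I ^ n).IsHomogeneous ℬ := by
  induction n with
  | zero => rw [pow_zero, Ideal.one_eq_top]; exact Ideal.IsHomogeneous.top ℬ
  | succ n ih => rw [pow_succ]; exact ih.mul h

/-- An element of minimal width in an ideal divides every element of the ideal up to homogeneous
factors. -/
theorem exists_homogeneous_mul_dvd {I : Ideal A} {a : A} {l w : ℕ}
    (haI : a ∈ I) (ha : GradedRing.proj 𝒜 (l + w) a ≠ 0)
    (haw : ∀ i, GradedRing.proj 𝒜 i a ≠ 0 → l ≤ i ∧ i ≤ l + w)
    (hmin : ∀ b ∈ I, b ≠ 0 → ∀ l' w', (∀ i, GradedRing.proj 𝒜 i b ≠ 0 → l' ≤ i ∧ i ≤ l' + w') →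
      w ≤ w') (w' : ℕ) :
    ∀ b ∈ I, ∀ l', (∀ i, GradedRing.proj 𝒜 i b ≠ 0 → l' ≤ i ∧ i ≤ l' + w') →
      ∃ (s : A) (d : ℕ), s ∈ 𝒜 d ∧ s ≠ 0 ∧ a ∣ s * b := by
  induction w' using Nat.strong_induction_on with | _ w' ih
  intro b hb l' hbw
  rcases eq_or_ne b 0 with rfl | hb0
  · exact ⟨1, 0, SetLike.one_mem_graded 𝒜, one_ne_zero, by simp⟩
  have hww' := hmin b hb hb0 l' w' hbw
  set α := GradedRing.proj 𝒜 (l + w) a with hα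
  set β := GradedRing.proj 𝒜 (l' + w') b with hβ
  have hαm : α ∈ 𝒜 (l + w) := proj_mem 𝒜 _ _
  have hβm : β ∈ 𝒜 (l' + w') := proj_mem 𝒜 _ _
  rcases eq_or_ne (α * b - β * a) 0 with hc | hc
  · exact ⟨α, l + w, hαm, ha, by rw [sub_eq_zero.mp hc]; exact dvd_mul_left _ _⟩
  have hproj : ∀ n, GradedRing.proj 𝒜 n (α * b - β * a) ≠ 0 →
      l + w + l' ≤ n ∧ n < l + w + l' + w' := by
    intro n hn
    have hbn : GradedRing.proj 𝒜 n (α * b) =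
        if l + w ≤ n then α * GradedRing.proj 𝒜 (n - (l + w)) b else 0 :=
      coe_decompose_mul_of_left_mem 𝒜 n hαm
    have han : GradedRing.proj 𝒜 n (β * a) =
        if l' + w' ≤ n then β * GradedRing.proj 𝒜 (n - (l' + w')) a else 0 :=
      coe_decompose_mul_of_left_mem 𝒜 n hβm
    have hle : l + w + l' ≤ n ∧ n ≤ l + w + l' + w' := by
      rw [map_sub, hbn, han] at hn
      by_contra hcon
      apply hn
      rw [sub_eq_zero]
      trans 0
      · split_ifs with h
        · rw [mul_eq_zero]
          by_contra! hne
          have := hbw _ hne.2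
          omega
        · rfl
      · split_ifs with h
        · symm
          rw [mul_eq_zero]
          by_contra! hne
          have := haw _ hne.2
          omega
        · rfl
    refine ⟨hle.1, lt_of_le_of_ne hle.2 ?_⟩
    rintro rfl
    rw [map_sub, hbn, han, if_pos (by omega), if_pos (by omega),
      show l + w + l' + w' - (l + w) = l' + w' by omega,
      show l + w + l' + w' - (l' + w') = l + w by omega, ← hα, ← hβ, mul_comm, sub_self] at hn
    exact hn rfl
  obtain ⟨n, hn⟩ : ∃ n, GradedRing.proj 𝒜 n (α * b - β * a) ≠ 0 := by
    by_contra! h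
    exact hc (eq_zero_of_forall_proj 𝒜 h)
  have hw'pos := hproj n hn
  obtain ⟨s, d, hs, hs0, t, ht⟩ := ih (w' - 1) (by omega) (α * b - β * a)
    (I.sub_mem (I.mul_mem_left _ hb) (I.mul_mem_left _ haI)) (l + w + l') (fun n hn ↦ by
      have := hproj n hn
      omega)
  refine ⟨s * α, d + (l + w), SetLike.mul_mem_graded hs hαm, mul_ne_zero hs0 ha, t + s * β, ?_⟩
  linear_combination ht

variable [IsNoetherianRing A] [IsIntegrallyClosed A]

theorem ordAt_eq_zero_of_not_isHomogeneous {q : PrimeSpectrum A}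
    (hq : (Set.Iio q).chainHeight = 1) (hqh : ¬ q.asIdeal.IsHomogeneous 𝒜)
    {f : A} {d : ℕ} (hf : f ∈ 𝒜 d) (hf0 : f ≠ 0) : ordAt q f = 0 :=
  (ordAt_eq_zero_iff hq hf0).mpr fun h ↦ hqh (isHomogeneous_of_mem hq hf hf0 h)

/-- The order of vanishing along a homogeneous prime divisor does not drop when passing to
homogeneous components. -/
theorem ordAt_le_ordAt_proj {p : PrimeSpectrum A} (hp : (Set.Iio p).chainHeight = 1)
    (hph : p.asIdeal.IsHomogeneous 𝒜) {f : A} (hf : f ≠ 0) {i : ℕ}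
    (hfi : GradedRing.proj 𝒜 i f ≠ 0) : ordAt p f ≤ ordAt p (GradedRing.proj 𝒜 i f) := by
  have := isDiscreteValuationRing_of_chainHeight hp
  let S := Localization.AtPrime p.asIdeal
  obtain ⟨ϖ, hϖ⟩ := IsDiscreteValuationRing.exists_irreducible S
  let φ : A →+* S[X] := (Polynomial.mapRingHom (algebraMap A S)).comp (gradedToPolynomial 𝒜)
  have hφ : ∀ g j, (φ g).coeff j = algebraMap A S (GradedRing.proj 𝒜 j g) := fun g j ↦ by
    simp [φ, coeff_gradedToPolynomial]
  have hpow : ∀ (n : ℕ) (x : S), x ∈ IsLocalRing.maximalIdeal S ^ n ↔ ϖ ^ n ∣ x := fun n x ↦ by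
    rw [hϖ.maximalIdeal_eq, Ideal.span_singleton_pow, Ideal.mem_span_singleton]
  have hmem := (mem_pow_iff_le_ordAt hp hf _).mpr le_rfl
  rw [← Localization.AtPrime.map_eq_maximalIdeal, algebraMap_mem_map_pow_iff] at hmem
  obtain ⟨s, hs, hsf⟩ := hmem
  have hdvd : C ϖ ^ ordAt p f ∣ φ s * φ f := by
    rw [← map_mul, ← C_pow, C_dvd_iff_dvd_coeff]
    intro j
    rw [hφ, ← hpow, ← Localization.AtPrime.map_eq_maximalIdeal, ← Ideal.map_pow]
    exact Ideal.mem_map_of_mem _ (hph.pow _ j hsf)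
  have hndvd : ¬ C ϖ ∣ φ s := by
    rw [C_dvd_iff_dvd_coeff]
    intro h
    refine hs (mem_of_forall_proj_mem 𝒜 fun j ↦ ?_)
    rw [← IsLocalization.AtPrime.to_map_mem_maximal_iff S p.asIdeal, ← pow_one
      (IsLocalRing.maximalIdeal S), hpow, pow_one, ← hφ]
    exact h j
  have := (prime_C_iff.mpr hϖ.prime).pow_dvd_of_dvd_mul_left _ hndvd hdvd
  rw [← C_pow, C_dvd_iff_dvd_coeff] at this
  rw [← mem_pow_iff_le_ordAt hp hfi, hpow, ← hφ]
  exact this i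

theorem exists_ordAt_eq_one_of_not_isHomogeneous {q : PrimeSpectrum A}
    (hq : (Set.Iio q).chainHeight = 1) (hqh : ¬ q.asIdeal.IsHomogeneous 𝒜) :
    ∃ a : A, a ≠ 0 ∧ ordAt q a = 1 ∧ ∀ p : PrimeSpectrum A, (Set.Iio p).chainHeight = 1 →
      ¬ p.asIdeal.IsHomogeneous 𝒜 → p ≠ q → ordAt p a = 0 := by
  classical
  obtain ⟨b, hbq, hb0, hb1⟩ := exists_mem_ordAt_eq_one_of_span hq (Ideal.span_eq q.asIdeal)
  have hex : ∃ w, ∃ a ∈ q.asIdeal, a ≠ 0 ∧ ∃ l,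
      ∀ i, GradedRing.proj 𝒜 i a ≠ 0 → l ≤ i ∧ i ≤ l + w := by
    obtain ⟨s, hs⟩ : ∃ s : Finset ℕ, ∀ i, GradedRing.proj 𝒜 i b ≠ 0 → i ∈ s :=
      ⟨_, fun i hi ↦ (GradedRing.mem_support_iff 𝒜 b i).mpr hi⟩
    exact ⟨s.sup id, b, hbq, hb0, 0, fun i hi ↦
      ⟨Nat.zero_le _, (Finset.le_sup (f := id) (hs i hi)).trans_eq (zero_add _).symm⟩⟩
  obtain ⟨a, haq, ha0, l, haw⟩ := Nat.find_spec hex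
  have hmin : ∀ b ∈ q.asIdeal, b ≠ 0 → ∀ l' w',
      (∀ i, GradedRing.proj 𝒜 i b ≠ 0 → l' ≤ i ∧ i ≤ l' + w') → Nat.find hex ≤ w' :=
    fun b hb hb0 l' w' h ↦ Nat.find_min' hex ⟨b, hb, hb0, l', h⟩
  generalize Nat.find hex = w at haw hmin
  have hatop : GradedRing.proj 𝒜 (l + w) a ≠ 0 := by
    intro h
    have hlt : ∀ i, GradedRing.proj 𝒜 i a ≠ 0 → l ≤ i ∧ i < l + w := fun i hi ↦
      ⟨(haw i hi).1, lt_of_le_of_ne (haw i hi).2 (by rintro rfl; exact hi h)⟩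
    obtain ⟨i, hi⟩ : ∃ i, GradedRing.proj 𝒜 i a ≠ 0 := by
      by_contra! h
      exact ha0 (eq_zero_of_forall_proj 𝒜 h)
    have h1 := hlt i hi
    have := hmin a haq ha0 l (w - 1) fun i hi ↦ by
      have := hlt i hi
      omega
    omega
  have key : ∀ c ∈ q.asIdeal, ∃ (s : A) (d : ℕ), s ∈ 𝒜 d ∧ s ≠ 0 ∧ a ∣ s * c := by
    intro c hc
    obtain ⟨s, hs⟩ : ∃ s : Finset ℕ, ∀ i, GradedRing.proj 𝒜 i c ≠ 0 → i ∈ s :=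
      ⟨_, fun i hi ↦ (GradedRing.mem_support_iff 𝒜 c i).mpr hi⟩
    exact exists_homogeneous_mul_dvd haq hatop haw hmin (s.sup id) c hc 0 fun i hi ↦
      ⟨Nat.zero_le _, (Finset.le_sup (f := id) (hs i hi)).trans_eq (zero_add _).symm⟩
  refine ⟨a, ha0, ?_, fun p hp hph hpq ↦ ?_⟩
  · obtain ⟨s, d, hs, hs0, t, ht⟩ := key b hbq
    have ht0 : t ≠ 0 := by
      rintro rfl
      exact mul_ne_zero hs0 hb0 (by rw [ht, mul_zero])
    have h1 := congrArg (ordAt q) ht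
    rw [ordAt_mul hq hs0 hb0, ordAt_mul hq ha0 ht0, hb1,
      ordAt_eq_zero_of_not_isHomogeneous hq hqh hs hs0] at h1
    have h2 := (ordAt_eq_zero_iff hq ha0).not_left.mpr haq
    omega
  · rw [ordAt_eq_zero_iff hp ha0]
    intro hap
    have hle : q.asIdeal ≤ p.asIdeal := by
      intro c hc
      obtain ⟨s, d, hs, hs0, hdvd⟩ := key c hc
      refine (p.2.mem_or_mem (Ideal.mem_of_dvd _ hdvd hap)).resolve_left fun hsp ↦ ?_
      exact hph (isHomogeneous_of_mem hp hs hs0 hsp)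
    exact hpq (((chainHeight_Iio_eq_one_iff p).mp hp).2 q
      ((chainHeight_Iio_eq_one_iff q).mp hq).1 hle).symm

end GradedDomain

section StandardGraded

open DirectSum

theorem exists_sub_algebraMap_mem_span {k A : Type} [CommRing k] [CommRing A] [Algebra k A]
    {s : Set A} (hs : Algebra.adjoin k s = ⊤) (a : A) :
    ∃ c : k, a - algebraMap k A c ∈ Ideal.span s := by
  have ha : a ∈ Algebra.adjoin k s := hs ▸ Algebra.mem_top
  induction ha using Algebra.adjoin_induction with
  | mem x hx => exact ⟨0, by simpa using Ideal.subset_span hx⟩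
  | algebraMap c => exact ⟨c, by simp⟩
  | add x y _ _ hx hy =>
    obtain ⟨c, hc⟩ := hx
    obtain ⟨d, hd⟩ := hy
    exact ⟨c + d, by simpa [add_sub_add_comm] using Ideal.add_mem _ hc hd⟩
  | mul x y _ _ hx hy =>
    obtain ⟨c, hc⟩ := hx
    obtain ⟨d, hd⟩ := hy
    refine ⟨c * d, ?_⟩
    have : x * y - algebraMap k A (c * d) =
        y * (x - algebraMap k A c) + algebraMap k A c * (y - algebraMap k A d) := by
      rw [map_mul]; ring
    rw [this]
    exact Ideal.add_mem _ (Ideal.mul_mem_left _ _ hc) (Ideal.mul_mem_left _ _ hd)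

theorem not_le_span_singleton_of_two_le_ringKrullDim {k A : Type} [Field k] [CommRing A] [Algebra k A]
    {V : Submodule k A} (hV : Algebra.adjoin k (V : Set A) = ⊤) (hdim : 2 ≤ ringKrullDim A) (x : A) :
    ¬ V ≤ Submodule.span k {x} := by
  intro h
  have hx : Algebra.adjoin k {x} = ⊤ := by
    rw [eq_top_iff, ← hV]
    refine Algebra.adjoin_le fun y hy ↦ ?_
    exact Algebra.span_le_adjoin k _ (h hy)
  have hsurj : Function.Surjective (Polynomial.aeval (R := k) x) := by
    rw [← AlgHom.range_eq_top, ← Algebra.adjoin_singleton_eq_range_aeval, hx]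
  have h1 := ringKrullDim_le_of_surjective (Polynomial.aeval (R := k) x).toRingHom hsurj
  rw [IsPrincipalIdealRing.ringKrullDim_eq_one _ (Polynomial.not_isField k)] at h1
  exact absurd (hdim.trans h1) (by decide)

theorem exists_mem_ne_zero_of_two_le_ringKrullDim {k A : Type} [Field k] [CommRing A] [Algebra k A]
    {V : Submodule k A} (hV : Algebra.adjoin k (V : Set A) = ⊤) (hdim : 2 ≤ ringKrullDim A) :
    ∃ x ∈ V, x ≠ 0 := by
  by_contra! h
  exact not_le_span_singleton_of_two_le_ringKrullDim hV hdim 0 fun x hx ↦ by simp [h x hx]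

variable {k A : Type} [Field k] [CommRing A] [Algebra k A]
variable {𝒜 : ℕ → Submodule k A} [GradedAlgebra 𝒜]

local notation "𝔪" => HomogeneousIdeal.toIdeal (HomogeneousIdeal.irrelevant 𝒜)

theorem mem_irrelevant_toIdeal_iff {a : A} : a ∈ 𝔪 ↔ GradedRing.proj 𝒜 0 a = 0 := Iff.rfl

theorem mem_irrelevant_toIdeal_of_mem {a : A} {d : ℕ} (hd : d ≠ 0) (ha : a ∈ 𝒜 d) : a ∈ 𝔪 :=
  mem_irrelevant_toIdeal_iff.mpr (decompose_of_mem_ne 𝒜 ha hd)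

theorem span_one_le_irrelevant : Ideal.span (𝒜 1 : Set A) ≤ 𝔪 :=
  Ideal.span_le.mpr fun _ ↦ mem_irrelevant_toIdeal_of_mem one_ne_zero

variable (hstd : Algebra.adjoin k ((𝒜 1 : Submodule k A) : Set A) = ⊤)
include hstd

theorem exists_proj_zero_eq_algebraMap (a : A) :
    ∃ c : k, GradedRing.proj 𝒜 0 a = algebraMap k A c := by
  obtain ⟨c, hc⟩ := exists_sub_algebraMap_mem_span hstd a
  have := mem_irrelevant_toIdeal_iff.mp (span_one_le_irrelevant hc)
  rw [map_sub, sub_eq_zero] at this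
  exact ⟨c, this.trans (decompose_of_mem_same 𝒜 (SetLike.algebraMap_mem_graded 𝒜 c))⟩

theorem span_one_eq_irrelevant : Ideal.span (𝒜 1 : Set A) = 𝔪 := by
  refine le_antisymm span_one_le_irrelevant fun a ha ↦ ?_
  obtain ⟨c, hc⟩ := exists_sub_algebraMap_mem_span hstd a
  have h := mem_irrelevant_toIdeal_iff.mp (span_one_le_irrelevant hc)
  rw [map_sub, mem_irrelevant_toIdeal_iff.mp ha, zero_sub, neg_eq_zero] at h
  have h' : algebraMap k A c = 0 :=
    (decompose_of_mem_same 𝒜 (SetLike.algebraMap_mem_graded 𝒜 c)).symm.trans h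
  rwa [h', sub_zero] at hc

theorem le_irrelevant_of_isHomogeneous {p : Ideal A} [p.IsPrime] (hp : p.IsHomogeneous 𝒜) :
    p ≤ 𝔪 := by
  intro a ha
  obtain ⟨c, hc⟩ := exists_proj_zero_eq_algebraMap hstd a
  have h0 : GradedRing.proj 𝒜 0 a ∈ p := hp 0 ha
  rw [mem_irrelevant_toIdeal_iff, hc]
  rw [hc] at h0
  by_contra hne
  have hc0 : c ≠ 0 := by rintro rfl; exact hne (map_zero _)
  exact ‹p.IsPrime›.ne_top (Ideal.eq_top_of_isUnit_mem _ h0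
    ((isUnit_iff_ne_zero.mpr hc0).map (algebraMap k A)))

variable (hdim : 2 ≤ ringKrullDim A)
include hdim

variable [IsDomain A] [IsNoetherianRing A] [IsIntegrallyClosed A]

theorem chainHeight_Iio_irrelevant_ne_one (hm : Ideal.IsPrime 𝔪) :
    (Set.Iio (⟨𝔪, hm⟩ : PrimeSpectrum A)).chainHeight ≠ 1 := by
  intro h
  obtain ⟨x, hx, hx0, hx1⟩ := exists_mem_ordAt_eq_one_of_span h (span_one_eq_irrelevant hstd)
  refine not_le_span_singleton_of_two_le_ringKrullDim hstd hdim x fun y hy ↦ ?_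
  rcases eq_or_ne y 0 with rfl | hy0
  · exact zero_mem _
  have hym : y ∈ 𝔪 := mem_irrelevant_toIdeal_of_mem one_ne_zero hy
  obtain ⟨ϖ, hϖ, hass⟩ := exists_irreducible_forall_associated_ordAt h
  have hy1 : 1 ≤ ordAt (⟨𝔪, hm⟩ : PrimeSpectrum A) y := by
    have := (ordAt_eq_zero_iff h hy0).not_left.mpr hym
    omega
  have hdvd := (((hass x hx0).dvd.trans (pow_dvd_pow ϖ (hx1.trans_le hy1))).trans
    (hass y hy0).symm.dvd)
  obtain ⟨z, hz⟩ := hdvd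
  obtain ⟨t, s, rfl⟩ := IsLocalization.exists_mk'_eq (𝔪).primeCompl z
  rw [IsLocalization.mul_mk'_eq_mk'_of_mul, IsLocalization.eq_mk'_iff_mul_eq, ← map_mul] at hz
  have hz' := IsLocalization.injective _ (𝔪).primeCompl_le_nonZeroDivisors hz
  have hcomp := congrArg (GradedRing.proj 𝒜 (0 + 1)) hz'
  have e1 : GradedRing.proj 𝒜 (0 + 1) (y * s) = y * GradedRing.proj 𝒜 0 (s : A) := by
    rw [mul_comm y, mul_comm y]
    exact coe_decompose_mul_add_of_right_mem 𝒜 hy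
  have e2 : GradedRing.proj 𝒜 (0 + 1) (x * t) = x * GradedRing.proj 𝒜 0 t := by
    rw [mul_comm x, mul_comm x]
    exact coe_decompose_mul_add_of_right_mem 𝒜 hx
  obtain ⟨c, hc⟩ := exists_proj_zero_eq_algebraMap hstd (s : A)
  obtain ⟨d, hd⟩ := exists_proj_zero_eq_algebraMap hstd t
  rw [e1, e2, hc, hd] at hcomp
  have hc0 : c ≠ 0 := by
    rintro rfl
    exact s.2 (mem_irrelevant_toIdeal_iff.mpr (hc.trans (map_zero _)))
  refine Submodule.mem_span_singleton.mpr ⟨c⁻¹ * d, ?_⟩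
  rw [mul_smul, Algebra.smul_def d, mul_comm _ x, ← hcomp, mul_comm y, ← Algebra.smul_def,
    inv_smul_smul₀ hc0]

theorem not_irrelevant_le_of_chainHeight (hm : Ideal.IsPrime 𝔪) {p : PrimeSpectrum A}
    (hp : (Set.Iio p).chainHeight = 1) (hph : p.asIdeal.IsHomogeneous 𝒜) : ¬ 𝔪 ≤ p.asIdeal := by
  intro h
  have : p = ⟨𝔪, hm⟩ :=
    PrimeSpectrum.ext (le_antisymm (le_irrelevant_of_isHomogeneous hstd hph) h)
  exact chainHeight_Iio_irrelevant_ne_one hstd hdim hm (this ▸ hp)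

end StandardGraded

section ProjDivisors

variable {k A : Type} [CommRing k] [CommRing A] [Algebra k A]
variable {𝒜 : ℕ → Submodule k A} [GradedAlgebra 𝒜]

/-- A relevant height one prime, as a height one prime. -/
def RelevantHeightOnePrime.toHeightOnePrime (p : RelevantHeightOnePrime 𝒜) : HeightOnePrime A :=
  ⟨p.1, p.2.2.1⟩

theorem RelevantHeightOnePrime.toHeightOnePrime_injective :
    Function.Injective (toHeightOnePrime (𝒜 := 𝒜)) :=
  fun _ _ h ↦ Subtype.ext (congrArg (fun q : HeightOnePrime A ↦ q.1) h)

variable [IsDomain A] [IsNoetherianRing A] [IsIntegrallyClosed A]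

theorem mem_projPrincipalDivisors_iff {D : RelevantHeightOnePrime 𝒜 →₀ ℤ} :
    D ∈ projPrincipalDivisors 𝒜 ↔ ∃ (d : ℕ) (f g : A), f ∈ 𝒜 d ∧ g ∈ 𝒜 d ∧ f ≠ 0 ∧ g ≠ 0 ∧
      ∀ p : RelevantHeightOnePrime 𝒜, D p = (ordAt p.1 f : ℤ) - (ordAt p.1 g : ℤ) := by
  refine ⟨fun h ↦ ?_, fun h ↦ AddSubgroup.subset_closure h⟩
  induction h using AddSubgroup.closure_induction with
  | mem D h => exact h
  | zero => exact ⟨0, 1, 1, SetLike.one_mem_graded 𝒜, SetLike.one_mem_graded 𝒜, one_ne_zero,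
      one_ne_zero, fun p ↦ by simp⟩
  | add D E _ _ hD hE =>
    obtain ⟨d, f, g, hfd, hgd, hf, hg, h⟩ := hD
    obtain ⟨d', f', g', hfd', hgd', hf', hg', h'⟩ := hE
    refine ⟨d + d', f * f', g * g', SetLike.mul_mem_graded hfd hfd',
      SetLike.mul_mem_graded hgd hgd', mul_ne_zero hf hf', mul_ne_zero hg hg', fun p ↦ ?_⟩
    rw [Finsupp.add_apply, h, h', ordAt_mul p.2.2.1 hf hf', ordAt_mul p.2.2.1 hg hg']
    push_cast
    ring
  | neg D _ hD =>
    obtain ⟨d, f, g, hfd, hgd, hf, hg, h⟩ := hD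
    exact ⟨d, g, f, hgd, hfd, hg, hf, fun p ↦ by rw [Finsupp.neg_apply, h]; ring⟩

variable (𝒜) in
/-- The divisor on `Proj` of a homogeneous element. -/
noncomputable def projDivisorOf (f : A) : RelevantHeightOnePrime 𝒜 →₀ ℤ :=
  (divisorOf f).comapDomain _ RelevantHeightOnePrime.toHeightOnePrime_injective.injOn

theorem projDivisorOf_apply {f : A} (hf : f ≠ 0) (p : RelevantHeightOnePrime 𝒜) :
    projDivisorOf 𝒜 f p = ordAt p.1 f :=
  divisorOf_apply hf p.toHeightOnePrime

end ProjDivisors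

section Comparison

open DirectSum

theorem ordAt_eq_zero_of_isUnit {R : Type} [CommRing R] [IsDomain R] [IsNoetherianRing R]
    [IsIntegrallyClosed R] {p : PrimeSpectrum R} (hp : (Set.Iio p).chainHeight = 1) {u : R}
    (hu : IsUnit u) : ordAt p u = 0 :=
  (ordAt_eq_zero_iff hp hu.ne_zero).mpr fun h ↦ p.2.ne_top (Ideal.eq_top_of_isUnit_mem _ h hu)

theorem ordAt_eq_of_associated {R : Type} [CommRing R] [IsDomain R] [IsNoetherianRing R]
    [IsIntegrallyClosed R] {p : PrimeSpectrum R} (hp : (Set.Iio p).chainHeight = 1) {f g : R}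
    (hf : f ≠ 0) (h : Associated f g) : ordAt p f = ordAt p g := by
  obtain ⟨u, rfl⟩ := h
  rw [ordAt_mul hp hf u.ne_zero, ordAt_eq_zero_of_isUnit hp u.isUnit, add_zero]

instance {A : Type} [CommRing A] [IsDomain A] [IsIntegrallyClosed A] (P : Ideal A) [P.IsPrime] :
    IsIntegrallyClosed (Localization.AtPrime P) :=
  isIntegrallyClosed_of_isLocalization _ P.primeCompl P.primeCompl_le_nonZeroDivisors

theorem exists_associated_algebraMap {A : Type} [CommRing A] {P : Ideal A} [P.IsPrime]
    (F : Localization.AtPrime P) : ∃ f : A, Associated F (algebraMap A _ f) := by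
  obtain ⟨a, s, rfl⟩ := IsLocalization.exists_mk'_eq P.primeCompl F
  exact ⟨a, (IsLocalization.map_units _ s).unit, by simp⟩

variable {k A : Type} [CommRing k] [CommRing A] [IsDomain A] [Algebra k A]
variable {𝒜 : ℕ → Submodule k A} [GradedAlgebra 𝒜]

section

variable [IsNoetherianRing A] [IsIntegrallyClosed A]

theorem exists_homogeneous_add_ordAt_nonneg (D : RelevantHeightOnePrime 𝒜 →₀ ℤ) :
    ∃ (n : ℕ) (t : A), t ∈ 𝒜 n ∧ t ≠ 0 ∧ ∀ p, 0 ≤ D p + ordAt p.1 t := by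
  induction D using Finsupp.induction_linear with
  | zero => exact ⟨0, 1, SetLike.one_mem_graded 𝒜, one_ne_zero, by simp⟩
  | add D E hD hE =>
    obtain ⟨n, t, htn, ht, h⟩ := hD
    obtain ⟨m, u, hum, hu, h'⟩ := hE
    refine ⟨n + m, t * u, SetLike.mul_mem_graded htn hum, mul_ne_zero ht hu, fun p ↦ ?_⟩
    rw [ordAt_mul p.2.2.1 ht hu, Finsupp.add_apply]
    have := h p
    have := h' p
    push_cast
    linarith
  | single p c =>
    obtain ⟨u, n, hun, hu, hup⟩ : ∃ u n, u ∈ 𝒜 n ∧ u ≠ 0 ∧ u ∈ p.1.asIdeal := by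
      obtain ⟨a, hap, ha⟩ := Submodule.exists_mem_ne_zero_of_ne_bot
        ((chainHeight_Iio_eq_one_iff p.1).mp p.2.2.1).1
      obtain ⟨i, hi⟩ : ∃ i, GradedRing.proj 𝒜 i a ≠ 0 := by
        by_contra! h
        exact ha (eq_zero_of_forall_proj 𝒜 h)
      exact ⟨_, i, proj_mem 𝒜 i a, hi, p.2.1 i hap⟩
    refine ⟨c.natAbs • n, u ^ c.natAbs, SetLike.pow_mem_graded _ hun, pow_ne_zero _ hu,
      fun q ↦ ?_⟩
    rw [ordAt_pow q.2.2.1 hu]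
    rcases eq_or_ne p q with rfl | hpq
    · have := (ordAt_eq_zero_iff p.2.2.1 hu).not_left.mpr hup
      have h1 : c.natAbs ≤ c.natAbs * ordAt p.1 u := Nat.le_mul_of_pos_right _ (by omega)
      rw [Finsupp.single_eq_same]
      omega
    · rw [Finsupp.single_eq_of_ne hpq.symm]
      positivity

section

variable (hrel : ∀ p : HeightOnePrime A, p.1.asIdeal.IsHomogeneous 𝒜 →
  ¬ (HomogeneousIdeal.irrelevant 𝒜).toIdeal ≤ p.1.asIdeal)
include hrel

theorem dvd_of_ordAt_le_of_homogeneous {f g : A} {d : ℕ} (hgd : g ∈ 𝒜 d) (hg : g ≠ 0)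
    (h : ∀ p : RelevantHeightOnePrime 𝒜, ordAt p.1 g ≤ ordAt p.1 f) : g ∣ f := by
  refine dvd_of_ordAt_le hg fun p ↦ ?_
  by_cases hp : p.1.asIdeal.IsHomogeneous 𝒜
  · exact h ⟨p.1, hp, p.2, hrel p hp⟩
  · rw [ordAt_eq_zero_of_not_isHomogeneous p.2 hp hgd hg]
    exact Nat.zero_le _

theorem eq_zero_of_nsmul_projDivisorOf_mem {x : A} (hx : x ∈ 𝒜 1) (hx0 : x ≠ 0) {n : ℕ}
    (h : n • projDivisorOf 𝒜 x ∈ projPrincipalDivisors 𝒜) : n = 0 := by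
  obtain ⟨d, f, g, hfd, hgd, hf, hg, hfg⟩ := mem_projPrincipalDivisors_iff.mp h
  have hxn := pow_ne_zero n hx0
  have hxgd : x ^ n * g ∈ 𝒜 (n + d) :=
    SetLike.mul_mem_graded (by simpa using SetLike.pow_mem_graded n hx) hgd
  obtain ⟨w, hw⟩ := dvd_of_ordAt_le_of_homogeneous hrel (f := f) hxgd (mul_ne_zero hxn hg) fun p ↦ by
    have := hfg p
    rw [Finsupp.smul_apply, projDivisorOf_apply hx0, nsmul_eq_mul] at this
    rw [ordAt_mul p.2.2.1 hxn hg, ordAt_pow p.2.2.1 hx0]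
    zify
    linarith
  by_contra hn
  apply hf
  rw [← decompose_of_mem_same 𝒜 hfd, hw]
  exact coe_decompose_mul_of_left_mem_of_not_le 𝒜 hxgd (by omega)

theorem eq_zero_of_zsmul_projDivisorOf_mem {x : A} (hx : x ∈ 𝒜 1) (hx0 : x ≠ 0) {n : ℤ}
    (h : n • projDivisorOf 𝒜 x ∈ projPrincipalDivisors 𝒜) : n = 0 := by
  obtain ⟨m, rfl | rfl⟩ := n.eq_nat_or_neg
  · rw [natCast_zsmul] at h
    simpa using eq_zero_of_nsmul_projDivisorOf_mem hrel hx hx0 h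
  · rw [neg_smul, natCast_zsmul, neg_mem_iff] at h
    simpa using eq_zero_of_nsmul_projDivisorOf_mem hrel hx hx0 h

end

variable {P : Ideal A} [P.IsPrime]

/-- An element of the local ring at `P` whose divisor comes from `Proj` may be replaced by a
homogeneous element. -/
theorem exists_homogeneous_ordAt_eq {h : A} (h0 : h ≠ 0)
    (hh : ∀ q : HeightOnePrime (Localization.AtPrime P),
      ¬ q.comapAtPrime.1.asIdeal.IsHomogeneous 𝒜 → ordAt q.1 (algebraMap A _ h) = 0) :
    ∃ (d : ℕ) (f : A), f ∈ 𝒜 d ∧ f ≠ 0 ∧ ∀ q : HeightOnePrime (Localization.AtPrime P),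
      ordAt q.1 (algebraMap A _ f) = ordAt q.1 (algebraMap A _ h) := by
  have h0' : algebraMap A (Localization.AtPrime P) h ≠ 0 := by simpa
  have hdvd : ∀ i, algebraMap A (Localization.AtPrime P) h ∣
      algebraMap A (Localization.AtPrime P) (GradedRing.proj 𝒜 i h) := by
    intro i
    by_cases hi : GradedRing.proj 𝒜 i h = 0
    · rw [hi, map_zero]
      exact dvd_zero _
    refine dvd_of_ordAt_le h0' fun q ↦ ?_
    by_cases hq : q.comapAtPrime.1.asIdeal.IsHomogeneous 𝒜
    · rw [q.ordAt_algebraMap, q.ordAt_algebraMap]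
      exact ordAt_le_ordAt_proj q.comapAtPrime.2 hq h0 hi
    · rw [hh q hq]
      exact Nat.zero_le _
  choose c hc using hdvd
  obtain ⟨s, hs⟩ := sum_proj 𝒜 h
  have hsum : ∑ i ∈ s, c i = 1 := by
    apply mul_left_cancel₀ h0'
    rw [Finset.mul_sum, mul_one]
    simp_rw [← hc]
    rw [← map_sum, hs]
  obtain ⟨i, hi⟩ : ∃ i, IsUnit (c i) := by
    by_contra! hcon
    have : (1 : Localization.AtPrime P) ∈ IsLocalRing.maximalIdeal (Localization.AtPrime P) := by
      rw [← hsum]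
      exact Ideal.sum_mem _ fun i _ ↦ (IsLocalRing.mem_maximalIdeal _).mpr (hcon i)
    exact (IsLocalRing.mem_maximalIdeal _).mp this isUnit_one
  have hass : Associated (algebraMap A (Localization.AtPrime P) h)
      (algebraMap A (Localization.AtPrime P) (GradedRing.proj 𝒜 i h)) := ⟨hi.unit, (hc i).symm⟩
  refine ⟨i, _, proj_mem 𝒜 i h, fun hi0 ↦ h0' ?_, fun q ↦
    (ordAt_eq_of_associated q.2 h0' hass).symm⟩
  rw [hi0, map_zero] at hass
  exact hass.eq_zero_iff.mpr rfl

end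

variable {P : Ideal A} [P.IsPrime]

/-- The extension of relevant height one primes to the localization at a prime containing all
of them. -/
def RelevantHeightOnePrime.mapAtPrime (hP : ∀ p : RelevantHeightOnePrime 𝒜, p.1.asIdeal ≤ P)
    (p : RelevantHeightOnePrime 𝒜) : HeightOnePrime (Localization.AtPrime P) :=
  HeightOnePrime.mapAtPrime p.1 p.2.2.1 (hP p)

variable (hP : ∀ p : RelevantHeightOnePrime 𝒜, p.1.asIdeal ≤ P)

theorem RelevantHeightOnePrime.comapAtPrime_mapAtPrime (p : RelevantHeightOnePrime 𝒜) :
    (mapAtPrime hP p).comapAtPrime.1 = p.1 :=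
  HeightOnePrime.comapAtPrime_mapAtPrime p.2.2.1 (hP p)

theorem RelevantHeightOnePrime.mapAtPrime_injective :
    Function.Injective (mapAtPrime hP) := fun p q h ↦ Subtype.ext <| by
  rw [← comapAtPrime_mapAtPrime hP, h, comapAtPrime_mapAtPrime]

theorem RelevantHeightOnePrime.ordAt_mapAtPrime (p : RelevantHeightOnePrime 𝒜) (f : A) :
    ordAt (mapAtPrime hP p).1 (algebraMap A _ f) = ordAt p.1 f := by
  rw [HeightOnePrime.ordAt_algebraMap, comapAtPrime_mapAtPrime]

variable (hrel : ∀ p : HeightOnePrime A, p.1.asIdeal.IsHomogeneous 𝒜 →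
  ¬ (HomogeneousIdeal.irrelevant 𝒜).toIdeal ≤ p.1.asIdeal)
include hrel

theorem RelevantHeightOnePrime.mem_range_mapAtPrime {q : HeightOnePrime (Localization.AtPrime P)}
    (hq : q.comapAtPrime.1.asIdeal.IsHomogeneous 𝒜) : q ∈ Set.range (mapAtPrime hP) :=
  ⟨⟨q.comapAtPrime.1, hq, q.comapAtPrime.2, hrel _ hq⟩, q.mapAtPrime_comapAtPrime⟩

variable [IsNoetherianRing A] [IsIntegrallyClosed A]

theorem mapDomain_projDivisorOf {f : A} {d : ℕ} (hfd : f ∈ 𝒜 d) (hf : f ≠ 0) :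
    Finsupp.mapDomain (RelevantHeightOnePrime.mapAtPrime hP) (projDivisorOf 𝒜 f) =
      divisorOf (algebraMap A (Localization.AtPrime P) f) := by
  have hf' : algebraMap A (Localization.AtPrime P) f ≠ 0 := by simpa
  have hinj := RelevantHeightOnePrime.mapAtPrime_injective hP
  ext q
  rw [divisorOf_apply hf']
  by_cases hq : q ∈ Set.range (RelevantHeightOnePrime.mapAtPrime hP)
  · obtain ⟨p, rfl⟩ := hq
    rw [Finsupp.mapDomain_apply hinj, projDivisorOf_apply hf,
      RelevantHeightOnePrime.ordAt_mapAtPrime]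
  · rw [Finsupp.mapDomain_of_notMem_range _ _ hq, q.ordAt_algebraMap,
      ordAt_eq_zero_of_not_isHomogeneous q.comapAtPrime.2 (fun h ↦ hq
        (RelevantHeightOnePrime.mem_range_mapAtPrime hP hrel h)) hfd hf, Nat.cast_zero]

theorem projPrincipalDivisors_le_comap_mapDomain :
    projPrincipalDivisors 𝒜 ≤ (principalDivisors (Localization.AtPrime P)).comap
      (Finsupp.mapDomain.addMonoidHom (RelevantHeightOnePrime.mapAtPrime hP)) := by
  intro D hD
  obtain ⟨d, f, g, hfd, hgd, hf, hg, h⟩ := mem_projPrincipalDivisors_iff.mp hD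
  have hD : D = projDivisorOf 𝒜 f - projDivisorOf 𝒜 g := by
    ext p
    rw [h, Finsupp.sub_apply, projDivisorOf_apply hf, projDivisorOf_apply hg]
  rw [AddSubgroup.mem_comap, hD, map_sub]
  change Finsupp.mapDomain _ _ - Finsupp.mapDomain _ _ ∈ _
  rw [mapDomain_projDivisorOf hP hrel hfd hf, mapDomain_projDivisorOf hP hrel hgd hg]
  exact sub_mem (divisorOf_mem_principalDivisors (by simpa))
    (divisorOf_mem_principalDivisors (by simpa))

/-- The homomorphism from the class group of `Proj` to that of the local ring at `P`. -/
noncomputable def ClProj.toDivClassGroup : ClProj 𝒜 →+ DivClassGroup (Localization.AtPrime P) :=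
  QuotientAddGroup.map _ _ _ (projPrincipalDivisors_le_comap_mapDomain hP hrel)

theorem ClProj.toDivClassGroup_mk (D : RelevantHeightOnePrime 𝒜 →₀ ℤ) :
    toDivClassGroup hP hrel (QuotientAddGroup.mk D) =
      QuotientAddGroup.mk (Finsupp.mapDomain (RelevantHeightOnePrime.mapAtPrime hP) D) := rfl

theorem exists_sub_mapDomain_mem_principalDivisors
    (D : HeightOnePrime (Localization.AtPrime P) →₀ ℤ) :
    ∃ E, Finsupp.mapDomain (RelevantHeightOnePrime.mapAtPrime hP) E - D ∈
      principalDivisors (Localization.AtPrime P) := by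
  induction D using Finsupp.induction_linear with
  | zero => exact ⟨0, by simp⟩
  | add D D' hD hD' =>
    obtain ⟨E, hE⟩ := hD
    obtain ⟨E', hE'⟩ := hD'
    refine ⟨E + E', ?_⟩
    rw [Finsupp.mapDomain_add, add_sub_add_comm]
    exact add_mem hE hE'
  | single q n =>
    suffices ∃ E, Finsupp.mapDomain (RelevantHeightOnePrime.mapAtPrime hP) E -
        Finsupp.single q 1 ∈ principalDivisors (Localization.AtPrime P) by
      obtain ⟨E, hE⟩ := this
      refine ⟨n • E, ?_⟩
      have := zsmul_mem hE n
      rwa [smul_sub, Finsupp.smul_single_one, ← Finsupp.mapDomain_smul] at this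
    by_cases hq : q.comapAtPrime.1.asIdeal.IsHomogeneous 𝒜
    · obtain ⟨p, rfl⟩ := RelevantHeightOnePrime.mem_range_mapAtPrime hP hrel hq
      exact ⟨Finsupp.single p 1, by simp⟩
    · obtain ⟨a, ha0, haq, ha⟩ := exists_ordAt_eq_one_of_not_isHomogeneous q.comapAtPrime.2 hq
      have ha0' : algebraMap A (Localization.AtPrime P) a ≠ 0 := by simpa
      refine ⟨(Finsupp.single q 1 - divisorOf (algebraMap A _ a)).comapDomain _
        (RelevantHeightOnePrime.mapAtPrime_injective hP).injOn, ?_⟩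
      rw [Finsupp.mapDomain_comapDomain _ (RelevantHeightOnePrime.mapAtPrime_injective hP),
        sub_sub_cancel_left]
      · exact neg_mem (divisorOf_mem_principalDivisors ha0')
      · intro r hr
        by_contra hr'
        have hrh : ¬ r.comapAtPrime.1.asIdeal.IsHomogeneous 𝒜 := fun h ↦
          hr' (RelevantHeightOnePrime.mem_range_mapAtPrime hP hrel h)
        apply Finsupp.mem_support_iff.mp hr
        rw [Finsupp.sub_apply, divisorOf_apply ha0', r.ordAt_algebraMap]
        rcases eq_or_ne q r with rfl | hqr
        · simp [haq]
        · rw [ha _ r.comapAtPrime.2 hrh fun h ↦ hqr ?_, Finsupp.single_eq_of_ne hqr.symm]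
          · simp
          · rw [← r.mapAtPrime_comapAtPrime, ← q.mapAtPrime_comapAtPrime]
            congr 1
            exact h.symm

theorem ClProj.toDivClassGroup_surjective :
    Function.Surjective (toDivClassGroup hP hrel) := by
  intro c
  obtain ⟨D, rfl⟩ := QuotientAddGroup.mk_surjective c
  obtain ⟨E, hE⟩ := exists_sub_mapDomain_mem_principalDivisors hP hrel D
  refine ⟨QuotientAddGroup.mk E, ?_⟩
  rw [toDivClassGroup_mk]
  exact QuotientAddGroup.eq_iff_sub_mem.mpr hE

theorem exists_eq_sub_projDivisorOf {D : RelevantHeightOnePrime 𝒜 →₀ ℤ}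
    (hD : Finsupp.mapDomain (RelevantHeightOnePrime.mapAtPrime hP) D ∈
      principalDivisors (Localization.AtPrime P)) :
    ∃ (d n : ℕ) (f t : A), f ∈ 𝒜 d ∧ t ∈ 𝒜 n ∧ f ≠ 0 ∧ t ≠ 0 ∧
      D = projDivisorOf 𝒜 f - projDivisorOf 𝒜 t := by
  have hinj := RelevantHeightOnePrime.mapAtPrime_injective hP
  obtain ⟨n, t, htn, ht, htD⟩ := exists_homogeneous_add_ordAt_nonneg D
  obtain ⟨F, G, hF, hG, hFG⟩ := mem_principalDivisors_iff.mp hD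
  have ht' : algebraMap A (Localization.AtPrime P) t ≠ 0 := by simpa
  have hdiv : ∀ q, Finsupp.mapDomain (RelevantHeightOnePrime.mapAtPrime hP)
      (D + projDivisorOf 𝒜 t) q = ordAt q.1 (F * algebraMap A _ t) - ordAt q.1 G := by
    intro q
    rw [Finsupp.mapDomain_add, Finsupp.add_apply, hFG, mapDomain_projDivisorOf hP hrel htn ht,
      divisorOf_apply ht', ordAt_mul q.2 hF ht']
    push_cast
    ring
  have hnonneg : ∀ q, 0 ≤ Finsupp.mapDomain (RelevantHeightOnePrime.mapAtPrime hP)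
      (D + projDivisorOf 𝒜 t) q := by
    intro q
    by_cases hq : q ∈ Set.range (RelevantHeightOnePrime.mapAtPrime hP)
    · obtain ⟨p, rfl⟩ := hq
      rw [Finsupp.mapDomain_apply hinj, Finsupp.add_apply, projDivisorOf_apply ht]
      exact htD p
    · rw [Finsupp.mapDomain_of_notMem_range _ _ hq]
  obtain ⟨H, hH⟩ := dvd_of_ordAt_le (f := F * algebraMap A _ t) hG fun q ↦ by
    have := hnonneg q
    rw [hdiv] at this
    omega
  have hH0 : H ≠ 0 := by
    rintro rfl
    exact mul_ne_zero hF ht' (by simpa using hH)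
  obtain ⟨h, hh⟩ := exists_associated_algebraMap H
  have hh0 : h ≠ 0 := by
    rintro rfl
    exact hH0 (by simpa using hh)
  have hord : ∀ q : HeightOnePrime (Localization.AtPrime P),
      (ordAt q.1 (algebraMap A _ h) : ℤ) =
        Finsupp.mapDomain (RelevantHeightOnePrime.mapAtPrime hP) (D + projDivisorOf 𝒜 t) q := by
    intro q
    rw [hdiv, hH, ordAt_mul q.2 hG hH0, ordAt_eq_of_associated q.2 hH0 hh]
    push_cast
    ring
  obtain ⟨d, f, hfd, hf, hfh⟩ := exists_homogeneous_ordAt_eq (𝒜 := 𝒜) (P := P) hh0 fun q hq ↦ by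
    have := hord q
    rw [Finsupp.mapDomain_of_notMem_range] at this
    · exact_mod_cast this
    · rintro ⟨p, rfl⟩
      exact hq (RelevantHeightOnePrime.comapAtPrime_mapAtPrime hP p ▸ p.2.1)
  refine ⟨d, n, f, t, hfd, htn, hf, ht, ?_⟩
  ext p
  have := hord (RelevantHeightOnePrime.mapAtPrime hP p)
  rw [← hfh, Finsupp.mapDomain_apply hinj, RelevantHeightOnePrime.ordAt_mapAtPrime,
    Finsupp.add_apply] at this
  rw [Finsupp.sub_apply, projDivisorOf_apply hf, this, add_sub_cancel_right]

theorem ClProj.toDivClassGroup_mk_projDivisorOf {f : A} {d : ℕ} (hfd : f ∈ 𝒜 d) (hf : f ≠ 0) :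
    toDivClassGroup hP hrel (QuotientAddGroup.mk (projDivisorOf 𝒜 f)) = 0 := by
  rw [toDivClassGroup_mk, mapDomain_projDivisorOf hP hrel hfd hf]
  exact (QuotientAddGroup.eq_zero_iff _).mpr (divisorOf_mem_principalDivisors (by simpa))

theorem ClProj.exists_zsmul_eq_of_toDivClassGroup_eq_zero {x : A} (hx : x ∈ 𝒜 1) (hx0 : x ≠ 0)
    {c : ClProj 𝒜} (hc : toDivClassGroup hP hrel c = 0) :
    ∃ n : ℤ, n • (QuotientAddGroup.mk (projDivisorOf 𝒜 x) : ClProj 𝒜) = c := by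
  obtain ⟨D, rfl⟩ := QuotientAddGroup.mk_surjective c
  rw [toDivClassGroup_mk, QuotientAddGroup.eq_zero_iff] at hc
  obtain ⟨d, n, f, t, hfd, htn, hf, ht, rfl⟩ := exists_eq_sub_projDivisorOf hP hrel hc
  refine ⟨d - n, ?_⟩
  rw [← QuotientAddGroup.mk_zsmul, QuotientAddGroup.eq_iff_sub_mem]
  have hxn := pow_ne_zero n hx0
  have hxd := pow_ne_zero d hx0
  have hpow : ∀ n, x ^ n ∈ 𝒜 n := fun n ↦ by simpa using SetLike.pow_mem_graded n hx
  refine mem_projPrincipalDivisors_iff.mpr ⟨d + n, x ^ d * t, f * x ^ n,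
    SetLike.mul_mem_graded (hpow d) htn, SetLike.mul_mem_graded hfd (hpow n),
    mul_ne_zero hxd ht, mul_ne_zero hf hxn, fun p ↦ ?_⟩
  simp only [Finsupp.sub_apply, Finsupp.smul_apply, projDivisorOf_apply hx0,
    projDivisorOf_apply hf, projDivisorOf_apply ht, ordAt_mul p.2.2.1 hxd ht,
    ordAt_mul p.2.2.1 hf hxn, ordAt_pow p.2.2.1 hx0, smul_eq_mul]
  push_cast
  ring

end Comparison

open Function in
/-- Let `A` be the homogeneous coordinate ring (a standard graded noetherian normal
domain over a field `k`, of dimension at least 2) of a projective variety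
`X = Proj A`, and let `R` be the localization of `A` at the irrelevant maximal ideal.
Then there is an exact sequence `0 → ℤ → Cl(X) → Cl(R) → 0`'s left portion:
`ℤ → Cl(X) → Cl(R)` is exact, the first map (sending `1` to the class of a
hyperplane section) is injective and the second map (induced by `p ↦ pR`) is
surjective. -/
theorem statement16 (k A : Type) [Field k] [CommRing A] [Algebra k A]
    (𝒜 : ℕ → Submodule k A) [GradedAlgebra 𝒜]
    [IsDomain A] [IsIntegrallyClosed A] [IsNoetherianRing A]
    (hstd : Algebra.adjoin k ((𝒜 1 : Submodule k A) : Set A) = ⊤)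
    (hdim : 2 ≤ ringKrullDim A)
    (hm : (HomogeneousIdeal.irrelevant 𝒜).toIdeal.IsPrime) :
    letI := hm
    ∃ (ι : ℤ →+ ClProj 𝒜)
      (π : ClProj 𝒜 →+
        DivClassGroup (Localization.AtPrime (HomogeneousIdeal.irrelevant 𝒜).toIdeal)),
      Injective ι ∧
      (∀ f : A, f ∈ 𝒜 1 → f ≠ 0 → ∀ D : RelevantHeightOnePrime 𝒜 →₀ ℤ,
        (∀ p : RelevantHeightOnePrime 𝒜, D p = (ordAt p.1 f : ℤ)) →
        ι 1 = QuotientAddGroup.mk D) ∧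
      (∀ (p : RelevantHeightOnePrime 𝒜)
        (q : HeightOnePrime
          (Localization.AtPrime (HomogeneousIdeal.irrelevant 𝒜).toIdeal)),
        q.1.asIdeal = Ideal.map
          (algebraMap A (Localization.AtPrime (HomogeneousIdeal.irrelevant 𝒜).toIdeal))
          p.1.asIdeal →
        π (QuotientAddGroup.mk (Finsupp.single p 1)) =
          QuotientAddGroup.mk (Finsupp.single q 1)) ∧
      Surjective π ∧ Function.Exact ι π := by
  have hP : ∀ p : RelevantHeightOnePrime 𝒜,
      p.1.asIdeal ≤ (HomogeneousIdeal.irrelevant 𝒜).toIdeal :=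
    fun p ↦ le_irrelevant_of_isHomogeneous hstd p.2.1
  have hrel : ∀ p : HeightOnePrime A, p.1.asIdeal.IsHomogeneous 𝒜 →
      ¬ (HomogeneousIdeal.irrelevant 𝒜).toIdeal ≤ p.1.asIdeal :=
    fun p ↦ not_irrelevant_le_of_chainHeight hstd hdim hm p.2
  obtain ⟨x, hx, hx0⟩ := exists_mem_ne_zero_of_two_le_ringKrullDim hstd hdim
  let ξ : ClProj 𝒜 := QuotientAddGroup.mk (projDivisorOf 𝒜 x)
  refine ⟨zmultiplesHom _ ξ, ClProj.toDivClassGroup hP hrel, ?_, ?_, ?_,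
    ClProj.toDivClassGroup_surjective hP hrel, ?_⟩
  · refine (injective_iff_map_eq_zero _).mpr fun n hn ↦ ?_
    rw [zmultiplesHom_apply, ← QuotientAddGroup.mk_zsmul, QuotientAddGroup.eq_zero_iff] at hn
    exact eq_zero_of_zsmul_projDivisorOf_mem hrel hx hx0 hn
  · intro f hf hf0 D hD
    rw [zmultiplesHom_apply, one_smul, QuotientAddGroup.eq_iff_sub_mem,
      mem_projPrincipalDivisors_iff]
    exact ⟨1, x, f, hx, hf, hx0, hf0, fun p ↦ by
      rw [Finsupp.sub_apply, projDivisorOf_apply hx0, hD]⟩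
  · intro p q hq
    rw [ClProj.toDivClassGroup_mk, Finsupp.mapDomain_single]
    congr 2
    exact Subtype.ext (PrimeSpectrum.ext hq.symm)
  · refine fun c ↦ ⟨fun hc ↦ ?_, ?_⟩
    · exact ClProj.exists_zsmul_eq_of_toDivClassGroup_eq_zero hP hrel hx hx0 hc
    · rintro ⟨n, rfl⟩
      rw [zmultiplesHom_apply, map_zsmul, ClProj.toDivClassGroup_mk_projDivisorOf hP hrel hx hx0,
        smul_zero]
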